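/- Let k ≥ 1 and let ω(z,ε) = (z^{k+1} − ε)·v(z,ε) and ω̄(z,ε) = (z^{k+1} − ε)·v̄(z,ε) be two factored families of codimension k, with natural eigenvalue functions λ and λ̄ respectively. Then the two families are conjugate by an analytic change of coordinate and parameter — i.e., there exist r, ρ > 0, an analytic map ψ : B(0,r) × B(0,ρ) → ℂ with ψ(0,0) = 0 and z ↦ ψ(z,ε) injective for each ε, and an analytic map h : B(0,ρ) → ℂ with h(0) = 0 and h'(0) ≠ 0, such that ∂ψ/∂z(z,ε)·ω(z,ε) = ω̄(ψ(z,ε), h(ε)) on B(0,r) × B(0,ρ) — if and only if there exists an analytic map ξ near 0 of the form ξ(δ) = δ·g(δ^{k+1}) with g analytic near 0 and g(0) ≠ 0, such that λ(δ) = λ̄(ξ(δ)) for all δ in a neighborhood of 0. -/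

import Mathlib

open Metric Set Filter Complex

theorem AnalyticAt.intervalIntegral_comp_clm {E : Type*} [NormedAddCommGroup E] [NormedSpace ℂ E]
    {f : E → ℂ} (hf : AnalyticAt ℂ f 0) (L : ℝ → E →L[ℂ] E) (hL : Continuous L)
    (hb : ∀ t ∈ Set.uIoc (0 : ℝ) 1, ‖L t‖ ≤ 1) :
    AnalyticAt ℂ (fun y => ∫ t in (0 : ℝ)..1, f (L t y)) 0 := by
  obtain ⟨p, r, hp⟩ := hf
  let c : (n : ℕ) → ℝ → ContinuousMultilinearMap ℂ (fun _ : Fin n => E) ℂ := fun n t =>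
    (p n).compContinuousLinearMap (fun _ => L t)
  have hc : ∀ n, Continuous (c n) := fun n => by
    have h := (ContinuousMultilinearMap.compContinuousLinearMapContinuousMultilinear ℂ
      (fun _ : Fin n => E) (fun _ : Fin n => E) ℂ).cont
    have h2 : Continuous fun t : ℝ => fun _ : Fin n => L t := continuous_pi fun _ => hL
    exact (h.comp h2).clm_apply (continuous_const (y := p n))
  have hcn : ∀ n, ∀ t ∈ Set.uIoc (0 : ℝ) 1, ‖c n t‖ ≤ ‖p n‖ := fun n t ht => by
    refine (ContinuousMultilinearMap.norm_compContinuousLinearMap_le _ _).trans ?_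
    refine mul_le_of_le_one_right (norm_nonneg _) ?_
    exact Finset.prod_le_one (fun _ _ => norm_nonneg _) (fun _ _ => hb t ht)
  let q : FormalMultilinearSeries ℂ E ℂ := fun n => ∫ t in (0 : ℝ)..1, c n t
  have hq : ∀ n, ‖q n‖ ≤ ‖p n‖ := fun n => by
    have := intervalIntegral.norm_integral_le_of_norm_le_const (hcn n)
    simpa using this
  have hqe : ∀ n (y : E), q n (fun _ => y) = ∫ t in (0 : ℝ)..1, p n (fun _ => L t y) := by
    intro n y
    have := ContinuousLinearMap.intervalIntegral_comp_comm
      (ContinuousMultilinearMap.apply ℂ (fun _ : Fin n => E) ℂ (fun _ => y))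
      ((hc n).intervalIntegrable (μ := MeasureTheory.volume) 0 1)
    exact this.symm
  refine ⟨q, r, ?_, hp.r_pos, ?_⟩
  · refine hp.r_le.trans (ENNReal.le_of_forall_nnreal_lt fun ρ hρ => ?_)
    refine q.le_radius_of_summable ?_
    refine Summable.of_nonneg_of_le (fun n => by positivity) (fun n => ?_)
      (p.summable_norm_mul_pow hρ)
    gcongr
    exact hq n
  · intro y hy
    simp only [zero_add, hqe]
    have hys : Summable fun n => ‖p n‖ * ‖y‖ ^ n := by
      refine p.summable_norm_mul_pow (r := ‖y‖₊) (lt_of_lt_of_le ?_ hp.r_le)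
      simpa [enorm_eq_nnnorm] using hy
    have hLy : ∀ t ∈ Set.uIoc (0 : ℝ) 1, ‖L t y‖ ≤ ‖y‖ := fun t ht =>
      ((L t).le_opNorm y).trans (mul_le_of_le_one_left (norm_nonneg _) (hb t ht))
    refine intervalIntegral.hasSum_integral_of_dominated_convergence
      (fun n _ => ‖p n‖ * ‖y‖ ^ n) (fun n => ?_) (fun n => ?_) ?_ ?_ ?_
    · refine Continuous.aestronglyMeasurable ?_
      exact (p n).cont.comp (continuous_pi fun _ => hL.clm_apply continuous_const)
    · refine Eventually.of_forall fun t ht => ?_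
      refine ((p n).le_opNorm _).trans ?_
      simp only [Finset.prod_const, Finset.card_univ, Fintype.card_fin]
      gcongr
      exact hLy t ht
    · exact Eventually.of_forall fun t ht => hys
    · exact intervalIntegrable_const
    · refine Eventually.of_forall fun t ht => ?_
      have h := hp.hasSum (y := L t y) ?_
      · simpa using h
      · have h1 : ‖L t y‖₊ ≤ ‖y‖₊ := hLy t ht
        have h2 : (‖y‖₊ : ENNReal) < r := by simpa [enorm_eq_nnnorm] using hy
        simpa [enorm_eq_nnnorm] using lt_of_le_of_lt (by exact_mod_cast h1) h2

/-- A germ of an analytic function has an analytic primitive in the last variable. -/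
theorem AnalyticAt.exists_primitive_snd {H : Type*} [NormedAddCommGroup H] [NormedSpace ℂ H]
    {f : H × ℂ → ℂ} (hf : AnalyticAt ℂ f 0) :
    ∃ A : H × ℂ → ℂ, AnalyticAt ℂ A 0 ∧
      ∀ᶠ y in nhds (0 : H × ℂ), HasDerivAt (fun s => s * A (y.1, s)) (f y) y.2 := by
  let L : ℝ → H × ℂ →L[ℂ] H × ℂ := fun t =>
    (ContinuousLinearMap.fst ℂ H ℂ).prod ((t : ℂ) • ContinuousLinearMap.snd ℂ H ℂ)
  have hL : Continuous L := by
    have : L = fun t : ℝ => (ContinuousLinearMap.inl ℂ H ℂ).comp (ContinuousLinearMap.fst ℂ H ℂ)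
      + (t : ℂ) • (ContinuousLinearMap.inr ℂ H ℂ).comp (ContinuousLinearMap.snd ℂ H ℂ) := by
      funext t; ext <;> simp [L]
    rw [this]; fun_prop
  have hb : ∀ t ∈ Set.uIoc (0 : ℝ) 1, ‖L t‖ ≤ 1 := fun t ht => by
    rw [Set.uIoc_of_le zero_le_one] at ht
    refine ContinuousLinearMap.opNorm_le_bound _ zero_le_one fun y => ?_
    have : ‖(t : ℂ) * y.2‖ ≤ ‖y.2‖ := by
      rw [norm_mul]
      refine mul_le_of_le_one_left (norm_nonneg _) ?_
      rw [Complex.norm_real, Real.norm_of_nonneg ht.1.le]; exact ht.2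
    simp only [L, Prod.norm_def, one_mul]
    exact max_le_max le_rfl this
  refine ⟨_, hf.intervalIntegral_comp_clm L hL hb, ?_⟩
  obtain ⟨R, hR, hfR⟩ := Metric.eventually_nhds_iff_ball.1 hf.eventually_analyticAt
  filter_upwards [ball_mem_nhds _ hR] with y hy
  simp only [mem_ball_zero_iff, Prod.norm_def, max_lt_iff] at hy
  have hd : ∀ s ∈ ball (0 : ℂ) R, AnalyticAt ℂ (fun s => f (y.1, s)) s := fun s hs =>
    (hfR (y.1, s) (by simpa [Prod.norm_def] using ⟨hy.1, by simpa using hs⟩)).fun_comp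
      (by fun_prop)
  obtain ⟨G, hG⟩ := DifferentiableOn.isExactOn_ball (c := (0 : ℂ)) (r := R)
    (f := fun s => f (y.1, s)) (fun s hs => (hd s hs).differentiableAt.differentiableWithinAt)
  have hy2 : y.2 ∈ ball (0 : ℂ) R := by simpa using hy.2
  refine (((hG y.2 hy2).sub_const (G 0))).congr_of_eventuallyEq ?_
  filter_upwards [isOpen_ball.mem_nhds hy2] with s hs
  have hseg : ∀ t ∈ Set.Icc (0 : ℝ) 1, (0 : ℂ) + t • s ∈ ball (0 : ℂ) R := fun t ht => by
    have : ‖t • s‖ ≤ ‖s‖ := by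
      rw [norm_smul, Real.norm_of_nonneg ht.1]
      exact mul_le_of_le_one_left (norm_nonneg _) ht.2
    simpa using this.trans_lt (by simpa using hs)
  have key := intervalIntegral.integral_unitInterval_deriv_eq_sub (𝕜 := ℂ) (f := G)
    (f' := fun s => f (y.1, s)) (z₀ := 0) (z₁ := s) ?_ (fun t ht => hG _ (hseg t ht))
  · simpa [L] using key
  · intro t ht
    have h1 := (hd _ (hseg t ht)).continuousAt
    exact (ContinuousAt.comp (f := fun t : ℝ => (0 : ℂ) + t • s) h1
      (by fun_prop)).continuousWithinAt

attribute [fun_prop] analyticAt_fst analyticAt_snd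

/-- A germ with vanishing derivative in the last variable and vanishing at `0` is zero. -/
theorem eventually_eq_zero_of_hasDerivAt_snd {H : Type*} [NormedAddCommGroup H]
    {K : H × ℂ → ℂ}
    (hK : ∀ᶠ y in nhds (0 : H × ℂ), HasDerivAt (fun s => K (y.1, s)) 0 y.2)
    (hK0 : ∀ᶠ x in nhds (0 : H), K (x, 0) = 0) :
    ∀ᶠ y in nhds (0 : H × ℂ), K y = 0 := by
  obtain ⟨R, hR, hKR⟩ := Metric.eventually_nhds_iff_ball.1 hK
  have hK0' : ∀ᶠ y in nhds (0 : H × ℂ), K (y.1, 0) = 0 :=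
    (continuous_fst.tendsto (0 : H × ℂ)).eventually hK0
  filter_upwards [ball_mem_nhds _ hR, hK0'] with y hy hy0
  simp only [mem_ball_zero_iff, Prod.norm_def, max_lt_iff] at hy
  have hd : ∀ s ∈ ball (0 : ℂ) R, HasDerivAt (fun s => K (y.1, s)) 0 s := fun s hs =>
    hKR (y.1, s) (by simpa [Prod.norm_def] using ⟨hy.1, by simpa using hs⟩)
  have := (convex_ball (0 : ℂ) R).norm_image_sub_le_of_norm_hasDerivWithin_le
    (f := fun s => K (y.1, s)) (f' := fun _ => 0) (C := 0) (x := 0) (y := y.2)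
    (fun s hs => (hd s hs).hasDerivWithinAt) (by simp) (by simpa using hR) (by simpa using hy.2)
  simpa [hy0] using this

theorem DifferentiableAt.hasDerivAt_snd {H : Type*} [NormedAddCommGroup H] [NormedSpace ℂ H]
    {D : H × ℂ → ℂ} {y : H × ℂ} (hD : DifferentiableAt ℂ D y) :
    HasDerivAt (fun s => D (y.1, s)) (fderiv ℂ D y (0, 1)) y.2 :=
  hD.hasFDerivAt.comp_hasDerivAt (f := fun s => (y.1, s)) y.2
    ((hasDerivAt_const y.2 y.1).prodMk (hasDerivAt_id y.2))

theorem AnalyticAt.fderiv_apply_const {E : Type*} [NormedAddCommGroup E] [NormedSpace ℂ E]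
    {D : E → ℂ} {x : E} (hD : AnalyticAt ℂ D x) (e : E) :
    AnalyticAt ℂ (fun y => fderiv ℂ D y e) x :=
  ((ContinuousLinearMap.apply ℂ ℂ e).analyticAt _).fun_comp hD.fderiv

/-- Hadamard's lemma for analytic germs. -/
theorem AnalyticAt.exists_eq_snd_mul {H : Type*} [NormedAddCommGroup H] [NormedSpace ℂ H]
    {D : H × ℂ → ℂ} (hD : AnalyticAt ℂ D 0) (hD0 : ∀ᶠ x in nhds (0 : H), D (x, 0) = 0) :
    ∃ A : H × ℂ → ℂ, AnalyticAt ℂ A 0 ∧ ∀ᶠ y in nhds (0 : H × ℂ), D y = y.2 * A y := by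
  obtain ⟨A, hA, hA'⟩ := (hD.fderiv_apply_const (0, 1)).exists_primitive_snd
  refine ⟨A, hA, ?_⟩
  have : ∀ᶠ y in nhds (0 : H × ℂ), D y - y.2 * A y = 0 := by
    refine eventually_eq_zero_of_hasDerivAt_snd ?_ ?_
    · filter_upwards [hA', hD.eventually_analyticAt] with y h1 h2
      simpa using h2.differentiableAt.hasDerivAt_snd.fun_sub h1
    · simpa using hD0
  filter_upwards [this] with y hy using sub_eq_zero.1 hy

/-- An analytic germ vanishing on the curve `ε = z ^ n` is divisible by `z ^ n - ε`. -/
theorem AnalyticAt.exists_eq_pow_sub_mul {n : ℕ} (hn : n ≠ 0) {D : ℂ × ℂ → ℂ}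
    (hD : AnalyticAt ℂ D 0) (hD0 : ∀ᶠ δ in nhds (0 : ℂ), D (δ, δ ^ n) = 0) :
    ∃ q : ℂ × ℂ → ℂ, AnalyticAt ℂ q 0 ∧
      ∀ᶠ p in nhds (0 : ℂ × ℂ), D p = (p.1 ^ n - p.2) * q p := by
  have hm : AnalyticAt ℂ (fun p : ℂ × ℂ => (p.1, p.1 ^ n - p.2)) 0 := by fun_prop
  have hm0 : (fun p : ℂ × ℂ => (p.1, p.1 ^ n - p.2)) 0 = 0 := by simp [hn]
  obtain ⟨A, hA, hDA⟩ := AnalyticAt.exists_eq_snd_mul (H := ℂ)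
    (D := fun p => D (p.1, p.1 ^ n - p.2)) (hD.fun_comp_of_eq hm hm0)
    (by simpa using hD0)
  refine ⟨fun p => A (p.1, p.1 ^ n - p.2), hA.fun_comp_of_eq hm hm0, ?_⟩
  have ht : Tendsto (fun p : ℂ × ℂ => (p.1, p.1 ^ n - p.2)) (nhds 0) (nhds 0) := by
    change Tendsto _ _ (nhds ((0 : ℂ), (0 : ℂ)))
    simpa [ContinuousAt, hn] using hm.continuousAt
  filter_upwards [ht.eventually hDA] with p hp
  simpa using hp

theorem DifferentiableAt.hasDerivAt_fst_fst {D : (ℂ × ℂ) × ℂ → ℂ} {y : (ℂ × ℂ) × ℂ}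
    (hD : DifferentiableAt ℂ D y) :
    HasDerivAt (fun z => D ((z, y.1.2), y.2)) (fderiv ℂ D y ((1, 0), 0)) y.1.1 :=
  hD.hasFDerivAt.comp_hasDerivAt (f := fun z => ((z, y.1.2), y.2)) y.1.1
    (((hasDerivAt_id y.1.1).prodMk (hasDerivAt_const _ y.1.2)).prodMk (hasDerivAt_const _ y.2))

theorem DifferentiableAt.hasDerivAt_fst {D : ℂ × ℂ → ℂ} {y : ℂ × ℂ}
    (hD : DifferentiableAt ℂ D y) :
    HasDerivAt (fun z => D (z, y.2)) (fderiv ℂ D y (1, 0)) y.1 :=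
  hD.hasFDerivAt.comp_hasDerivAt (f := fun z => (z, y.2)) y.1
    ((hasDerivAt_id y.1).prodMk (hasDerivAt_const _ y.2))

/-- Implicit function theorem for analytic germs, solving for a scalar unknown. -/
theorem AnalyticAt.exists_implicit {H : Type*} [NormedAddCommGroup H] [NormedSpace ℂ H]
    [CompleteSpace H] {G : H × ℂ → ℂ} (hG : AnalyticAt ℂ G 0) (hG0 : G 0 = 0)
    (hG' : fderiv ℂ G 0 (0, 1) ≠ 0) :
    ∃ s : H → ℂ, AnalyticAt ℂ s 0 ∧ s 0 = 0 ∧ ∀ᶠ p in nhds (0 : H), G (p, s p) = 0 := by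
  have hc : ContDiffAt ℂ (⊤ : WithTop ℕ∞) G 0 := hG.contDiffAt
  have hi : (fderiv ℂ G 0 ∘L .inr ℂ H ℂ).IsInvertible := by
    refine ⟨ContinuousLinearEquiv.unitsEquivAut ℂ (Units.mk0 _ hG'), ?_⟩
    ext
    simp
  refine ⟨hc.implicitFunction (by simp) hi, ?_, ?_, ?_⟩
  · exact (hc.contDiffAt_implicitFunction (by simp) hi).analyticAt
  · exact hc.implicitFunction_apply_self (by simp) hi
  · simpa [hG0] using hc.eventually_apply_implicitFunction (by simp) hi

/-- Two analytic vector fields `(z ^ n - ε) v` and `(z ^ n - ε) w` whose units agree along the zero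
curve are conjugate by `z ↦ z + (z ^ n - ε) s(z, ε)` for some analytic germ `s`. -/
theorem exists_conjugacy_of_eq_on_zeros {n : ℕ} (hn : n ≠ 0) {v w : ℂ × ℂ → ℂ}
    (hv : AnalyticAt ℂ v 0) (hv0 : v 0 ≠ 0) (hw : AnalyticAt ℂ w 0) (hw0 : w 0 ≠ 0)
    (hvw : ∀ᶠ δ in nhds (0 : ℂ), v (δ, δ ^ n) = w (δ, δ ^ n)) :
    ∃ s : ℂ × ℂ → ℂ, AnalyticAt ℂ s 0 ∧ s 0 = 0 ∧ ∀ᶠ p in nhds (0 : ℂ × ℂ),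
      deriv (fun z => z + (z ^ n - p.2) * s (z, p.2)) p.1 * ((p.1 ^ n - p.2) * v p) =
        ((p.1 + (p.1 ^ n - p.2) * s p) ^ n - p.2) *
          w (p.1 + (p.1 ^ n - p.2) * s p, p.2) := by
  -- the quotient of the difference of the time forms
  obtain ⟨Q, hQ, hvwQ⟩ := ((hv.inv hv0).fun_sub (hw.inv hw0)).exists_eq_pow_sub_mul hn
    (by filter_upwards [hvw] with δ h; simp [h])
  have hswap : AnalyticAt ℂ (fun p : ℂ × ℂ => (p.2, p.1)) 0 := by fun_prop
  have hswapt : Tendsto (fun p : ℂ × ℂ => (p.2, p.1)) (nhds 0) (nhds 0) := by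
    change Tendsto _ _ (nhds ((0 : ℂ), (0 : ℂ)))
    simpa [ContinuousAt] using hswap.continuousAt
  obtain ⟨B, hB, hBd⟩ := (hQ.fun_comp_of_eq hswap rfl).exists_primitive_snd
  let τ : ℂ × ℂ → ℂ := fun p => p.1 * B (p.2, p.1)
  have hτ : AnalyticAt ℂ τ 0 := analyticAt_fst.fun_mul (hB.fun_comp_of_eq hswap rfl)
  have hτ' : ∀ᶠ p in nhds (0 : ℂ × ℂ), HasDerivAt (fun z => τ (z, p.2)) (Q p) p.1 :=
    hswapt.eventually hBd
  -- the moving point, and the target field and its time form along it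
  let m : (ℂ × ℂ) × ℂ → ℂ × ℂ := fun y => (y.1.1 + (y.1.1 ^ n - y.1.2) * y.2, y.1.2)
  have hm : AnalyticAt ℂ m 0 := by fun_prop
  have hm0 : m 0 = 0 := by simp [m]
  have hmt : Tendsto m (nhds 0) (nhds 0) := by simpa [ContinuousAt, hm0] using hm.continuousAt
  let c : (ℂ × ℂ) × ℂ → ℂ := fun y =>
    1 + y.2 * ∑ i ∈ Finset.range n, (m y).1 ^ i * y.1.1 ^ (n - 1 - i)
  have hc : AnalyticAt ℂ c 0 := by fun_prop
  have hcm : ∀ y, (m y).1 ^ n - y.1.2 = (y.1.1 ^ n - y.1.2) * c y := fun y => by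
    have h := geom_sum₂_mul (m y).1 y.1.1 n
    simp only [c]
    have h2 : (m y).1 - y.1.1 = (y.1.1 ^ n - y.1.2) * y.2 := by simp [m]
    rw [h2] at h
    linear_combination -h
  let W : ℂ × ℂ → ℂ := fun p => (p.1 ^ n - p.2) * w p
  have hW : AnalyticAt ℂ W 0 := by fun_prop
  let f : (ℂ × ℂ) × ℂ → ℂ := fun y => (c y * w (m y))⁻¹
  have hwm : AnalyticAt ℂ (fun y => w (m y)) 0 := hw.fun_comp_of_eq hm hm0
  have hcw0 : c 0 * w (m 0) ≠ 0 := by simp [c, hm0, hw0]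
  have hf : AnalyticAt ℂ f 0 := (hc.fun_mul hwm).fun_inv hcw0
  have hf0 : f 0 ≠ 0 := inv_ne_zero hcw0
  have hfW : ∀ᶠ y in nhds (0 : (ℂ × ℂ) × ℂ), f y * W (m y) = y.1.1 ^ n - y.1.2 := by
    filter_upwards [(hc.fun_mul hwm).continuousAt.eventually_ne hcw0] with y hy
    have : W (m y) = (y.1.1 ^ n - y.1.2) * (c y * w (m y)) := by
      rw [← mul_assoc, ← hcm]
    rw [this]
    simp only [f]
    rw [mul_comm, mul_assoc, mul_inv_cancel₀ hy, mul_one]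
  have hfz : ∀ x : ℂ × ℂ, f (x, 0) = (w x)⁻¹ := fun x => by simp [f, c, m]
  obtain ⟨A, hA, hA'⟩ := hf.exists_primitive_snd
  let F : (ℂ × ℂ) × ℂ → ℂ := fun y => y.2 * A y
  have hF : AnalyticAt ℂ F 0 := by fun_prop
  have hF3 : ∀ᶠ y in nhds (0 : (ℂ × ℂ) × ℂ), fderiv ℂ F y (0, 1) = f y := by
    filter_upwards [hA', hF.eventually_analyticAt] with y h1 h2
    exact h2.differentiableAt.hasDerivAt_snd.unique h1
  let F1 : (ℂ × ℂ) × ℂ → ℂ := fun y => fderiv ℂ F y ((1, 0), 0)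
  have hF1 : AnalyticAt ℂ F1 0 := hF.fderiv_apply_const _
  -- mixed partial derivatives
  have hF13 : ∀ᶠ y in nhds (0 : (ℂ × ℂ) × ℂ),
      fderiv ℂ F1 y (0, 1) = fderiv ℂ f y ((1, 0), 0) := by
    filter_upwards [hF3.eventually_nhds, hF.eventually_analyticAt] with y h1 h2
    have hs := (h2.contDiffAt (n := ⊤)).isSymmSndFDerivAt_of_omega
    have hd : DifferentiableAt ℂ (fderiv ℂ F) y := h2.fderiv.differentiableAt
    have e1 : fderiv ℂ f y = fderiv ℂ (fun y => fderiv ℂ F y (0, 1)) y :=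
      (EventuallyEq.fderiv_eq h1).symm
    rw [e1, fderiv_clm_apply hd (by fun_prop), fderiv_clm_apply hd (by fun_prop)]
    simpa using hs _ _
  have hK : ∀ᶠ y in nhds (0 : (ℂ × ℂ) × ℂ), (y.1.1 ^ n - y.1.2) *
      ((y.1.1 ^ n - y.1.2) * F1 y - (1 + n * y.1.1 ^ (n - 1) * y.2) * f y + f (y.1, 0)) = 0 := by
    refine eventually_eq_zero_of_hasDerivAt_snd ?_ ?_
    · filter_upwards [hF13, hF1.eventually_analyticAt, hf.eventually_analyticAt,
        hmt.eventually hW.eventually_analyticAt, hfW.eventually_nhds] with y h13 h1 h2 h3 h4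
      have d1 := h1.differentiableAt.hasDerivAt_snd
      rw [h13] at d1
      have d3 := h2.differentiableAt.hasDerivAt_snd
      have dz := h2.differentiableAt.hasDerivAt_fst_fst
      set fz := fderiv ℂ f y ((1, 0), 0)
      set ft := fderiv ℂ f y (0, 1)
      have dP : HasDerivAt (fun z : ℂ => z ^ n - y.1.2) (n * y.1.1 ^ (n - 1)) y.1.1 :=
        (hasDerivAt_pow n y.1.1).sub_const _
      set P' := (n : ℂ) * y.1.1 ^ (n - 1)
      have dW := h3.differentiableAt.hasDerivAt_fst
      set W' := fderiv ℂ W (m y) (1, 0)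
      have dWz : HasDerivAt (fun z => W (m ((z, y.1.2), y.2))) (W' * (1 + P' * y.2)) y.1.1 :=
        HasDerivAt.comp (h := fun z => z + (z ^ n - y.1.2) * y.2) y.1.1 dW
          ((hasDerivAt_id _).add (dP.mul_const _))
      have dWt : HasDerivAt (fun t => W (m (y.1, t))) (W' * (y.1.1 ^ n - y.1.2)) y.2 := by
        refine HasDerivAt.comp (h := fun t => y.1.1 + (y.1.1 ^ n - y.1.2) * t) y.2 dW ?_
        simpa using ((hasDerivAt_id y.2).const_mul (y.1.1 ^ n - y.1.2)).const_add y.1.1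
      have ct : ContinuousAt (fun t : ℂ => (y.1, t)) y.2 := by fun_prop
      have cz : ContinuousAt (fun z : ℂ => ((z, y.1.2), y.2)) y.1.1 := by fun_prop
      have r1 : fz * W (m y) + f y * (W' * (1 + P' * y.2)) = P' :=
        ((dz.mul dWz).congr_of_eventuallyEq
          ((cz.tendsto.eventually h4).mono fun z hz => hz.symm)).unique dP
      have r2 : ft * W (m y) + f y * (W' * (y.1.1 ^ n - y.1.2)) = 0 :=
        ((d3.mul dWt).congr_of_eventuallyEq
          ((ct.tendsto.eventually h4).mono fun z hz => hz.symm)).unique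
          (hasDerivAt_const y.2 (y.1.1 ^ n - y.1.2))
      have r3 := h4.self_of_nhds
      have dl : HasDerivAt (fun t => 1 + P' * t) P' y.2 := by
        simpa using ((hasDerivAt_id y.2).const_mul P').const_add 1
      have := (((d1.const_mul (y.1.1 ^ n - y.1.2)).sub (dl.mul d3)).add_const
        (f (y.1, 0))).const_mul (y.1.1 ^ n - y.1.2)
      convert! this using 1
      set P := y.1.1 ^ n - y.1.2
      linear_combination (P * fz - (1 + P' * y.2) * ft) * r3 - P * f y * r1
        + (1 + P' * y.2) * f y * r2
    · filter_upwards [((continuous_id.prodMk continuous_const).tendsto' (0 : ℂ × ℂ)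
        ((0 : ℂ × ℂ), (0 : ℂ)) rfl).eventually hF.eventually_analyticAt] with x hx
      have h0 : F1 (x, 0) = 0 := by
        refine (DifferentiableAt.hasDerivAt_fst_fst hx.differentiableAt).unique ?_
        simpa [F] using hasDerivAt_const x.1 (0 : ℂ)
      simp [h0]
  -- solve for the time
  obtain ⟨s, hs, hs0, hsF⟩ := AnalyticAt.exists_implicit (H := ℂ × ℂ)
    (G := fun y => F y - τ y.1) (hF.fun_sub (hτ.fun_comp_of_eq analyticAt_fst rfl))
    (by simp [F, τ]) (by
      have h1 : DifferentiableAt ℂ (fun y => F y - τ y.1) (0 : (ℂ × ℂ) × ℂ) :=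
        (hF.fun_sub (hτ.fun_comp_of_eq analyticAt_fst rfl)).differentiableAt
      have h2 := hF.differentiableAt.hasDerivAt_snd.sub_const (τ 0)
      rw [hF3.self_of_nhds] at h2
      rwa [h1.hasDerivAt_snd.unique h2])
  refine ⟨s, hs, hs0, ?_⟩
  have hsg : Tendsto (fun p => (p, s p)) (nhds (0 : ℂ × ℂ)) (nhds 0) := by
    change Tendsto _ _ (nhds ((0 : ℂ × ℂ), (0 : ℂ)))
    simpa [ContinuousAt, hs0] using continuousAt_id.prodMk hs.continuousAt
  filter_upwards [hsg.eventually hK, hsg.eventually hfW, hsF.eventually_nhds, hτ',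
    hsg.eventually (hf.continuousAt.eventually_ne hf0), hvwQ, hs.eventually_analyticAt,
    hsg.eventually hF.eventually_analyticAt, hsg.eventually hF3,
    hv.continuousAt.eventually_ne hv0] with p kK kf ksF kτ kf0 kQ ks kF kF3 kv0
  have ds := ks.differentiableAt.hasDerivAt_fst
  set s' := fderiv ℂ s p (1, 0)
  have dP : HasDerivAt (fun z : ℂ => z ^ n - p.2) (n * p.1 ^ (n - 1)) p.1 :=
    (hasDerivAt_pow n p.1).sub_const _
  have dψ := (hasDerivAt_id p.1).fun_add (dP.fun_mul ds)
  simp only [id] at dψ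
  rw [dψ.deriv]
  have dF : HasDerivAt (fun z => F ((z, p.2), s (z, p.2))) (F1 (p, s p) + f (p, s p) * s') p.1 := by
    have h1 := kF.differentiableAt.hasFDerivAt.comp_hasDerivAt
      (f := fun z => ((z, p.2), s (z, p.2))) p.1
      (((hasDerivAt_id p.1).prodMk (hasDerivAt_const _ p.2)).prodMk ds)
    convert! h1 using 1
    have h2 : (((1 : ℂ), (0 : ℂ)), s') = ((1, 0), 0) + s' • (0, 1) := by simp
    rw [h2, map_add, map_smul, kF3, smul_eq_mul, mul_comm s']
  have cz : ContinuousAt (fun z : ℂ => (z, p.2)) p.1 := by fun_prop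
  have e1 : F1 (p, s p) + f (p, s p) * s' = Q p := by
    refine dF.unique (kτ.congr_of_eventuallyEq ?_)
    filter_upwards [cz.tendsto.eventually ksF] with z hz using sub_eq_zero.1 hz
  rw [hfz] at kK
  have kQ' : (v p)⁻¹ - (w p)⁻¹ = (p.1 ^ n - p.2) * Q p := kQ
  change _ = W (m (p, s p))
  refine mul_left_cancel₀ kf0 ?_
  rw [kf]
  have kv : (v p)⁻¹ * v p = 1 := inv_mul_cancel₀ kv0
  set P := p.1 ^ n - p.2
  linear_combination -v p * kK + v p * P * P * e1 + P * kv - v p * P * kQ'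

/-- A germ strictly differentiable at the origin with nonzero first partial derivative is injective
in the first variable, uniformly in the second. -/
theorem HasStrictFDerivAt.exists_injOn_fst {Φ : ℂ × ℂ → ℂ} {Φ' : ℂ × ℂ →L[ℂ] ℂ}
    (hΦ : HasStrictFDerivAt Φ Φ' 0) (h0 : Φ' (1, 0) ≠ 0) :
    ∃ R > 0, ∀ ε ∈ ball (0 : ℂ) R, Set.InjOn (fun z => Φ (z, ε)) (ball 0 R) := by
  have hpos : 0 < ‖Φ' (1, 0)‖ := norm_pos_iff.2 h0
  have h1 := hΦ.isLittleO.def (half_pos hpos)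
  obtain ⟨R, hR, hb⟩ := Metric.eventually_nhds_iff_ball.1 h1
  refine ⟨R, hR, fun ε hε z hz z' hz' he => ?_⟩
  have h2 := hb ((z, ε), (z', ε)) (by
    simp only [mem_ball_zero_iff] at hz hz' hε
    have : ((0 : ℂ × ℂ), (0 : ℂ × ℂ)) = 0 := rfl
    simp [this, Prod.norm_def, hz, hz', hε])
  have h3 : ((z, ε) : ℂ × ℂ) - (z', ε) = (z - z') • ((1 : ℂ), (0 : ℂ)) := by simp
  simp only at he
  simp only [he, h3, map_smul, sub_self, zero_sub, norm_neg, norm_smul, smul_eq_mul, norm_mul] at h2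
  have h4 : ‖((1 : ℂ), (0 : ℂ))‖ = 1 := by simp [Prod.norm_def]
  rw [h4, mul_one] at h2
  by_contra hne
  have h5 : 0 < ‖z - z'‖ := norm_pos_iff.2 (sub_ne_zero.2 hne)
  nlinarith [mul_pos hpos h5]

theorem AnalyticAt.exists_eq_mul_of_map_zero {f : ℂ → ℂ} (hf : AnalyticAt ℂ f 0) (h0 : f 0 = 0) :
    ∃ H : ℂ → ℂ, AnalyticAt ℂ H 0 ∧ H 0 = deriv f 0 ∧ ∀ z, f z = z * H z := by
  obtain ⟨p, hp⟩ := hf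
  refine ⟨dslope f 0, ⟨_, hp.has_fpower_series_dslope_fslope⟩, dslope_same _ _, fun z => ?_⟩
  have := sub_smul_dslope f 0 z
  simpa [h0] using this.symm

theorem AnalyticAt.exists_pow_eq {H : ℂ → ℂ} (hH : AnalyticAt ℂ H 0) (h0 : H 0 ≠ 0) {n : ℕ}
    (hn : n ≠ 0) :
    ∃ G : ℂ → ℂ, AnalyticAt ℂ G 0 ∧ G 0 ≠ 0 ∧ ∀ᶠ z in nhds 0, G z ^ n = H z := by
  obtain ⟨c, hc⟩ := IsAlgClosed.exists_pow_nat_eq (H 0) (Nat.pos_of_ne_zero hn)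
  have hc0 : c ≠ 0 := by rintro rfl; simp [hn] at hc; exact h0 hc.symm
  have hq : AnalyticAt ℂ (fun z => H z / H 0) 0 := by fun_prop (disch := exact h0)
  refine ⟨fun z => c * Complex.exp (Complex.log (H z / H 0) / n), ?_, by simp [hc0], ?_⟩
  · refine analyticAt_const.fun_mul (AnalyticAt.cexp ?_)
    refine AnalyticAt.fun_div (hq.clog ?_) analyticAt_const (by simp [hn])
    simp [h0]
  · filter_upwards [hH.continuousAt.eventually_ne h0] with z hz
    have hn' : (n : ℂ) ≠ 0 := by simp [hn]
    rw [mul_pow, ← Complex.exp_nat_mul, mul_div_cancel₀ _ hn', Complex.exp_log (div_ne_zero hz h0), hc,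
      mul_div_cancel₀ _ h0]

theorem ContinuousAt.eventually_eq_of_pow_eq_one {u : ℂ → ℂ} (hu : ContinuousAt u 0) {n : ℕ}
    (hn : n ≠ 0) (h : ∀ᶠ z in nhds 0, u z ^ n = 1) : ∀ᶠ z in nhds 0, u z = u 0 := by
  have hfin : {z : ℂ | z ^ n = 1}.Finite := by
    refine (Polynomial.nthRootsFinset n (1 : ℂ)).finite_toSet.subset fun z hz => ?_
    simpa [Polynomial.mem_nthRootsFinset (Nat.pos_of_ne_zero hn)] using hz
  have ho : ∀ᶠ y in nhds (u 0), y ∉ {z : ℂ | z ^ n = 1} \ {u 0} :=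
    (hfin.subset sdiff_subset).isClosed.isOpen_compl.mem_nhds (by simp)
  filter_upwards [hu.eventually ho, h] with z h1 h2
  by_contra hne
  exact h1 ⟨h2, hne⟩

theorem AnalyticAt.eventually_eq_of_forall_ne {f g : ℂ → ℂ} (hf : AnalyticAt ℂ f 0)
    (hg : AnalyticAt ℂ g 0) (h : ∀ᶠ z in nhds 0, z ≠ 0 → f z = g z) :
    ∀ᶠ z in nhds 0, f z = g z :=
  (hf.frequently_eq_iff_eventually_eq hg).1 (eventually_nhdsWithin_of_eventually_nhds
    (s := {0}ᶜ) h |>.and self_mem_nhdsWithin |>.mono fun _ hz => hz.1 hz.2).frequently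

/-- A nonconstant germ conjugating two fields with zeros of the same order `n ≥ 2` is immersive. -/
theorem deriv_ne_zero_of_conjugacy {k : ℕ} (hk : 1 ≤ k) {φ a b : ℂ → ℂ} (hφ : AnalyticAt ℂ φ 0)
    (hφ0 : φ 0 = 0) (hne : ¬ ∀ᶠ z in nhds 0, φ z = 0) (ha : AnalyticAt ℂ a 0) (ha0 : a 0 ≠ 0)
    (hb : AnalyticAt ℂ b 0)
    (h : ∀ᶠ z in nhds 0, deriv φ z * (z ^ (k + 1) * a z) = φ z ^ (k + 1) * b (φ z)) :
    deriv φ 0 ≠ 0 := by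
  obtain ⟨m, χ, hχ, hχ0, hχe⟩ := hφ.exists_eventuallyEq_pow_smul_nonzero_iff.2 hne
  simp only [sub_zero, smul_eq_mul] at hχe
  have hd : ∀ᶠ z in nhds 0, deriv φ z = m * z ^ (m - 1) * χ z + z ^ m * deriv χ z := by
    filter_upwards [hχe.eventually_nhds, hχ.eventually_analyticAt] with z h1 h2
    exact (((hasDerivAt_pow m z).fun_mul h2.differentiableAt.hasDerivAt).congr_of_eventuallyEq
      h1).deriv
  obtain _ | _ | m := m
  · have := hχe.self_of_nhds
    simp [hφ0] at this
    exact absurd this.symm hχ0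
  · have := hd.self_of_nhds
    simpa [this] using hχ0
  · exfalso
    have hbφ : AnalyticAt ℂ (fun z => b (φ z)) 0 := hb.fun_comp_of_eq hφ hφ0
    have hχ' := hχ.deriv
    have h1 : ∀ᶠ z in nhds (0 : ℂ), ((m + 2 : ℂ) * χ z + z * deriv χ z) * a z =
        z ^ ((m + 1) * k) * χ z ^ (k + 1) * b (φ z) := by
      refine AnalyticAt.eventually_eq_of_forall_ne (by fun_prop)
        (AnalyticAt.fun_mul (by fun_prop) hbφ) ?_
      filter_upwards [h, hd, hχe] with z h2 h3 h4 hz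
      rw [h3, h4, ← h4] at h2
      have hz' : z ^ (m + 1 + k + 1) ≠ 0 := pow_ne_zero _ hz
      refine mul_left_cancel₀ hz' ?_
      rw [h4] at h2
      simp only [Nat.add_sub_cancel, Nat.cast_add, Nat.cast_one] at h2
      rw [mul_pow, ← h4] at h2
      have e : z ^ (m + 1 + k + 1) * z ^ ((m + 1) * k) = (z ^ (m + 1 + 1)) ^ (k + 1) := by
        rw [← pow_add, ← pow_mul]; congr 1; ring
      linear_combination h2 - χ z ^ (k + 1) * b (φ z) * e
    have := h1.self_of_nhds
    simp only [zero_mul, add_zero] at this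
    rw [zero_pow (Nat.mul_ne_zero (by omega) (by omega)), zero_mul, zero_mul] at this
    have hm : (m + 2 : ℂ) ≠ 0 := by exact_mod_cast (by omega : m + 2 ≠ 0)
    exact mul_ne_zero (mul_ne_zero hm hχ0) ha0 this

theorem exists_conjugacy_of_eigenvalue {k : ℕ} {v vb : ℂ → ℂ → ℂ}
    (hv : AnalyticAt ℂ (fun p : ℂ × ℂ => v p.1 p.2) (0, 0)) (hv0 : v 0 0 ≠ 0)
    (hvb : AnalyticAt ℂ (fun p : ℂ × ℂ => vb p.1 p.2) (0, 0)) (hvb0 : vb 0 0 ≠ 0)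
    {g : ℂ → ℂ} (hg : AnalyticAt ℂ g 0) (hg0 : g 0 ≠ 0)
    (hlam : ∀ᶠ δ in nhds (0 : ℂ), ((k : ℂ) + 1) * δ ^ k * v δ (δ ^ (k + 1))
      = ((k : ℂ) + 1) * (δ * g (δ ^ (k + 1))) ^ k *
          vb (δ * g (δ ^ (k + 1))) ((δ * g (δ ^ (k + 1))) ^ (k + 1))) :
    ∃ (r ρ : ℝ) (ψ : ℂ → ℂ → ℂ) (h : ℂ → ℂ), 0 < r ∧ 0 < ρ ∧
      AnalyticOnNhd ℂ (fun p : ℂ × ℂ => ψ p.1 p.2) (ball 0 r ×ˢ ball 0 ρ) ∧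
      ψ 0 0 = 0 ∧
      (∀ ε ∈ ball (0 : ℂ) ρ, Set.InjOn (fun z => ψ z ε) (ball 0 r)) ∧
      AnalyticOnNhd ℂ h (ball 0 ρ) ∧ h 0 = 0 ∧ deriv h 0 ≠ 0 ∧
      ∀ z ∈ ball (0 : ℂ) r, ∀ ε ∈ ball (0 : ℂ) ρ,
        deriv (fun z => ψ z ε) z * ((z ^ (k + 1) - ε) * v z ε)
          = (ψ z ε ^ (k + 1) - h ε) * vb (ψ z ε) (h ε) := by
  have hgp : AnalyticAt ℂ (fun p : ℂ × ℂ => g p.2) 0 := hg.fun_comp_of_eq analyticAt_snd rfl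
  let w : ℂ × ℂ → ℂ := fun p => g p.2 ^ k * vb (p.1 * g p.2) (p.2 * g p.2 ^ (k + 1))
  have hw : AnalyticAt ℂ w 0 := by
    refine (hgp.fun_pow k).fun_mul (hvb.fun_comp_of_eq
      (f := fun p : ℂ × ℂ => (p.1 * g p.2, p.2 * g p.2 ^ (k + 1))) (by fun_prop) (by simp))
  have hw0 : w 0 ≠ 0 := by simp [w, hg0, hvb0]
  have hcurve : AnalyticAt ℂ (fun δ : ℂ => (δ, δ ^ (k + 1))) 0 := by fun_prop
  have hvw : ∀ᶠ δ in nhds (0 : ℂ), v δ (δ ^ (k + 1)) = w (δ, δ ^ (k + 1)) := by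
    refine AnalyticAt.eventually_eq_of_forall_ne (hv.fun_comp_of_eq hcurve (by simp))
      (hw.fun_comp_of_eq hcurve (by simp)) ?_
    filter_upwards [hlam] with δ h1 hδ
    have hk1 : ((k : ℂ) + 1) * δ ^ k ≠ 0 :=
      mul_ne_zero (by exact_mod_cast k.succ_ne_zero) (pow_ne_zero _ hδ)
    refine mul_left_cancel₀ hk1 ?_
    rw [h1, mul_pow, mul_pow]
    simp only [w]
    ring
  obtain ⟨s, hs, hs0, hsE⟩ := exists_conjugacy_of_eq_on_zeros k.succ_ne_zero
    (v := fun p : ℂ × ℂ => v p.1 p.2) hv hv0 hw hw0 hvw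
  let Ψ : ℂ × ℂ → ℂ := fun p => g p.2 * (p.1 + (p.1 ^ (k + 1) - p.2) * s p)
  have hΨ : AnalyticAt ℂ Ψ 0 := by fun_prop
  let h : ℂ → ℂ := fun ε => ε * g ε ^ (k + 1)
  have hh : AnalyticAt ℂ h 0 := by fun_prop
  have hΨ' : fderiv ℂ Ψ 0 (1, 0) = g 0 * (1 + ((k + 1 : ℕ) * (0 : ℂ) ^ k * s 0 +
      ((0 : ℂ) ^ (k + 1) - 0) * fderiv ℂ s 0 (1, 0))) := by
    refine hΨ.differentiableAt.hasDerivAt_fst.unique ?_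
    exact ((hasDerivAt_id (0 : ℂ)).fun_add (((hasDerivAt_pow (k + 1) (0 : ℂ)).sub_const
      (0 : ℂ)).fun_mul hs.differentiableAt.hasDerivAt_fst)).const_mul (g 0)
  have hΨ0 : fderiv ℂ Ψ 0 (1, 0) ≠ 0 := by simpa [hΨ', hs0] using hg0
  obtain ⟨R₁, hR₁, hinj⟩ := hΨ.hasStrictFDerivAt.exists_injOn_fst hΨ0
  have hhp : ∀ᶠ p in nhds (0 : ℂ × ℂ), AnalyticAt ℂ h p.2 :=
    (continuous_snd.tendsto (0 : ℂ × ℂ)).eventually hh.eventually_analyticAt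
  obtain ⟨R₂, hR₂, hall⟩ := Metric.eventually_nhds_iff_ball.1
    ((hsE.and hΨ.eventually_analyticAt).and hhp)
  have hall' : ∀ z ∈ ball (0 : ℂ) (min R₁ R₂), ∀ ε ∈ ball (0 : ℂ) (min R₁ R₂), _ :=
    fun z hz ε hε => hall (z, ε) (by
      simp only [mem_ball_zero_iff, lt_min_iff] at hz hε
      simp [Prod.norm_def, hz.2, hε.2])
  have hpos : 0 < min R₁ R₂ := lt_min hR₁ hR₂
  have hsub : ball (0 : ℂ) (min R₁ R₂) ⊆ ball 0 R₁ := ball_subset_ball (min_le_left _ _)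
  refine ⟨min R₁ R₂, min R₁ R₂, fun z ε => Ψ (z, ε), h, hpos, hpos, ?_, by simp [Ψ], ?_, ?_,
    by simp [h], ?_, ?_⟩
  · exact fun p hp => (hall' p.1 hp.1 p.2 hp.2).1.2
  · exact fun ε hε => (hinj ε (hsub hε)).mono hsub
  · exact fun ε hε => (hall' 0 (mem_ball_self hpos) ε hε).2
  · have : deriv h 0 = g 0 ^ (k + 1) := by
      have h1 := (hasDerivAt_id (0 : ℂ)).fun_mul
        (hg.fun_pow (k + 1)).differentiableAt.hasDerivAt
      simpa using h1.deriv
    simp [this, hg0]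
  · intro z hz ε hε
    have e := (hall' z hz ε hε).1.1
    simp only [w, Nat.succ_eq_add_one] at e
    simp only [Ψ, h, deriv_const_mul_field, mul_pow (g ε)]
    rw [mul_comm (z + (z ^ (k + 1) - ε) * s (z, ε)) (g ε)] at e
    linear_combination g ε * e

theorem exists_eigenvalue_of_conjugacy {k : ℕ} (hk : 1 ≤ k) {v vb : ℂ → ℂ → ℂ}
    (hv : AnalyticAt ℂ (fun p : ℂ × ℂ => v p.1 p.2) (0, 0)) (hv0 : v 0 0 ≠ 0)
    (hvb : AnalyticAt ℂ (fun p : ℂ × ℂ => vb p.1 p.2) (0, 0)) (hvb0 : vb 0 0 ≠ 0)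
    {r ρ : ℝ} {ψ : ℂ → ℂ → ℂ} {h : ℂ → ℂ} (hr : 0 < r) (hρ : 0 < ρ)
    (hψ : AnalyticOnNhd ℂ (fun p : ℂ × ℂ => ψ p.1 p.2) (ball 0 r ×ˢ ball 0 ρ))
    (hψ0 : ψ 0 0 = 0) (hinj : ∀ ε ∈ ball (0 : ℂ) ρ, Set.InjOn (fun z => ψ z ε) (ball 0 r))
    (hh : AnalyticOnNhd ℂ h (ball 0 ρ)) (hh0 : h 0 = 0) (hh' : deriv h 0 ≠ 0)
    (hconj : ∀ z ∈ ball (0 : ℂ) r, ∀ ε ∈ ball (0 : ℂ) ρ,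
        deriv (fun z => ψ z ε) z * ((z ^ (k + 1) - ε) * v z ε)
          = (ψ z ε ^ (k + 1) - h ε) * vb (ψ z ε) (h ε)) :
    ∃ g : ℂ → ℂ, AnalyticAt ℂ g 0 ∧ g 0 ≠ 0 ∧
      ∀ᶠ δ in nhds (0 : ℂ),
        ((k : ℂ) + 1) * δ ^ k * v δ (δ ^ (k + 1))
          = ((k : ℂ) + 1) * (δ * g (δ ^ (k + 1))) ^ k *
              vb (δ * g (δ ^ (k + 1))) ((δ * g (δ ^ (k + 1))) ^ (k + 1)) := by
  have hr0 : (0 : ℂ) ∈ ball (0 : ℂ) r := mem_ball_self hr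
  have hρ0 : (0 : ℂ) ∈ ball (0 : ℂ) ρ := mem_ball_self hρ
  let Ψ : ℂ × ℂ → ℂ := fun p => ψ p.1 p.2
  have hΨ : AnalyticAt ℂ Ψ 0 := hψ (0, 0) ⟨hr0, hρ0⟩
  have hh1 : AnalyticAt ℂ h 0 := hh 0 hρ0
  have hcurve : AnalyticAt ℂ (fun δ : ℂ => (δ, δ ^ (k + 1))) 0 := by fun_prop
  have hcurvet : Tendsto (fun δ : ℂ => (δ, δ ^ (k + 1))) (nhds 0) (nhds 0) := by
    change Tendsto _ _ (nhds ((0 : ℂ), (0 : ℂ)))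
    simpa [ContinuousAt] using hcurve.continuousAt
  have hconj' : ∀ᶠ p in nhds (0 : ℂ × ℂ), deriv (fun z => ψ z p.2) p.1 *
      ((p.1 ^ (k + 1) - p.2) * v p.1 p.2)
        = (ψ p.1 p.2 ^ (k + 1) - h p.2) * vb (ψ p.1 p.2) (h p.2) := by
    filter_upwards [prod_mem_nhds (ball_mem_nhds (0 : ℂ) hr) (ball_mem_nhds (0 : ℂ) hρ)] with p hp
      using hconj p.1 hp.1 p.2 hp.2
  -- `ψ(·, 0)` is immersive at the origin
  have hΨ' : fderiv ℂ Ψ 0 (1, 0) ≠ 0 := by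
    have hi0 : AnalyticAt ℂ (fun z : ℂ => (z, (0 : ℂ))) 0 := by fun_prop
    have ha : AnalyticAt ℂ (fun z => v z 0) 0 := hv.fun_comp_of_eq hi0 rfl
    have hb : AnalyticAt ℂ (fun z => vb z 0) 0 := hvb.fun_comp_of_eq hi0 rfl
    have hφ : AnalyticAt ℂ (fun z => ψ z 0) 0 := hΨ.fun_comp_of_eq hi0 rfl
    have hd := deriv_ne_zero_of_conjugacy hk hφ hψ0 ?_ ha hv0 hb ?_
    · rwa [hΨ.differentiableAt.hasDerivAt_fst.deriv.symm]
    · intro hz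
      have hz' := (eventually_nhdsWithin_of_eventually_nhds (s := {0}ᶜ) hz).and
        ((eventually_nhdsWithin_of_eventually_nhds (ball_mem_nhds (0 : ℂ) hr)).and
          self_mem_nhdsWithin)
      obtain ⟨z, h1, h2, h3⟩ := hz'.exists
      exact h3 (hinj 0 hρ0 h2 hr0 (h1.trans hψ0.symm))
    · filter_upwards [ball_mem_nhds (0 : ℂ) hr] with z hz
      simpa [hh0] using hconj z hz 0 hρ0
  -- `ψ` maps zeros to zeros
  have hvbψ : AnalyticAt ℂ (fun p : ℂ × ℂ => vb (ψ p.1 p.2) (h p.2)) 0 :=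
    hvb.fun_comp_of_eq (f := fun p : ℂ × ℂ => (ψ p.1 p.2, h p.2))
      (hΨ.prod (hh1.fun_comp_of_eq analyticAt_snd rfl)) (by simp [hψ0, hh0])
  have hvbψ0 : ∀ᶠ p in nhds (0 : ℂ × ℂ), vb (ψ p.1 p.2) (h p.2) ≠ 0 :=
    hvbψ.continuousAt.eventually_ne (by simpa [hψ0, hh0] using hvb0)
  have hzero : ∀ᶠ δ in nhds (0 : ℂ), ψ δ (δ ^ (k + 1)) ^ (k + 1) = h (δ ^ (k + 1)) := by
    filter_upwards [hcurvet.eventually hconj', hcurvet.eventually hvbψ0] with δ h1 h2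
    simp only [sub_self, zero_mul, mul_zero] at h1
    exact sub_eq_zero.1 ((mul_eq_zero.1 h1.symm).resolve_right h2)
  -- the induced map on zeros has the required symmetry
  obtain ⟨H, hH, hH0, hhH⟩ := hh1.exists_eq_mul_of_map_zero hh0
  obtain ⟨G, hG, hG0, hGH⟩ := hH.exists_pow_eq (hH0 ▸ hh') k.succ_ne_zero
  have hξ : AnalyticAt ℂ (fun δ => ψ δ (δ ^ (k + 1))) 0 := hΨ.fun_comp_of_eq hcurve (by simp)
  obtain ⟨X, hX, -, hξX⟩ := hξ.exists_eq_mul_of_map_zero (by simpa using hψ0)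
  have hpowt : Tendsto (fun δ : ℂ => δ ^ (k + 1)) (nhds 0) (nhds 0) := by
    simpa using (continuous_pow (M := ℂ) (k + 1)).tendsto 0
  have hpow : AnalyticAt ℂ (fun δ : ℂ => δ ^ (k + 1)) 0 := by fun_prop
  have hGp : AnalyticAt ℂ (fun δ => G (δ ^ (k + 1))) 0 := hG.fun_comp_of_eq hpow (by simp)
  have hHp : AnalyticAt ℂ (fun δ => H (δ ^ (k + 1))) 0 := hH.fun_comp_of_eq hpow (by simp)
  have hXH : ∀ᶠ δ in nhds 0, X δ ^ (k + 1) = H (δ ^ (k + 1)) := by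
    refine AnalyticAt.eventually_eq_of_forall_ne (by fun_prop) hHp ?_
    filter_upwards [hzero] with δ h1 hδ
    rw [hξX, hhH, mul_pow] at h1
    exact mul_left_cancel₀ (pow_ne_zero _ hδ) h1
  have hGp0 : ∀ᶠ δ in nhds (0 : ℂ), G (δ ^ (k + 1)) ≠ 0 :=
    hpowt.eventually (hG.continuousAt.eventually_ne hG0)
  have hu := ContinuousAt.eventually_eq_of_pow_eq_one
    (hX.fun_div hGp hGp0.self_of_nhds).continuousAt k.succ_ne_zero (by
      filter_upwards [hXH, hpowt.eventually hGH, hGp0] with δ h1 h2 h3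
      rw [div_pow, h1, ← h2, div_self (pow_ne_zero _ h3)])
  set c := X 0 / G (0 ^ (k + 1)) with hc
  have hX0 : X 0 ≠ 0 := by
    intro h0
    have h1 := hXH.self_of_nhds
    rw [h0, zero_pow k.succ_ne_zero, hH0] at h1
    exact hh' h1.symm
  have hc0 : c ≠ 0 := div_ne_zero hX0 hGp0.self_of_nhds
  refine ⟨fun ε => c * G ε, analyticAt_const.fun_mul hG, mul_ne_zero hc0 hG0, ?_⟩
  have hΨ'0 : ∀ᶠ p in nhds (0 : ℂ × ℂ), fderiv ℂ Ψ p (1, 0) ≠ 0 :=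
    (hΨ.fderiv_apply_const (1, 0)).continuousAt.eventually_ne hΨ'
  filter_upwards [hu, hGp0, hzero, hcurvet.eventually hΨ'0,
    hcurvet.eventually hΨ.eventually_analyticAt, hcurvet.eventually hvbψ.eventually_analyticAt,
    hcurvet.eventually hv.eventually_analyticAt,
    hcurvet.eventually hconj'.eventually_nhds] with δ h1 h2 h3 h4 h5 h6 h7 h8
  have e1 : δ * (c * G (δ ^ (k + 1))) = ψ δ (δ ^ (k + 1)) := by
    rw [hξX, ← h1, div_mul_cancel₀ _ h2]
  rw [e1, h3]
  have d5 := h5.differentiableAt.hasDerivAt_fst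
  have d6 := h6.differentiableAt.hasDerivAt_fst
  have d7 := h7.differentiableAt.hasDerivAt_fst
  have d8 := (h5.fderiv_apply_const (1, 0)).differentiableAt.hasDerivAt_fst
  set a := fderiv ℂ Ψ (δ, δ ^ (k + 1)) (1, 0)
  have dl := d8.fun_mul ((((hasDerivAt_pow (k + 1) δ).sub_const (δ ^ (k + 1)))).fun_mul d7)
  have dr := ((d5.fun_pow (k + 1)).sub_const (h (δ ^ (k + 1)))).fun_mul d6
  have cz : ContinuousAt (fun z : ℂ => (z, δ ^ (k + 1))) δ := by fun_prop
  have key := dl.unique (dr.congr_of_eventuallyEq (by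
    filter_upwards [cz.tendsto.eventually h8, cz.tendsto.eventually h5.eventually_analyticAt]
      with z hz hz'
    rw [← hz'.differentiableAt.hasDerivAt_fst.deriv]
    exact hz))
  refine mul_left_cancel₀ h4 ?_
  simp only [Ψ, h3, sub_self, zero_mul, mul_zero, add_zero, zero_add, Nat.add_sub_cancel,
    Nat.cast_add, Nat.cast_one] at key
  linear_combination key

/-- Two factored families `(z^{k+1}−ε)·v(z,ε)` and `(z^{k+1}−ε)·v̄(z,ε)`
of codimension `k` are conjugate by an analytic change of coordinate and parameter
`(ψ, h)` if and only if their natural eigenvalue functions satisfy `λ = λ̄∘ξ` near `0` for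
some symmetric change `ξ(δ) = δ·g(δ^{k+1})` with `g` analytic, `g(0) ≠ 0`. -/
theorem statement18 (k : ℕ) (hk : 1 ≤ k) (v vb : ℂ → ℂ → ℂ)
    (hv : AnalyticAt ℂ (fun p : ℂ × ℂ => v p.1 p.2) (0, 0)) (hv0 : v 0 0 ≠ 0)
    (hvb : AnalyticAt ℂ (fun p : ℂ × ℂ => vb p.1 p.2) (0, 0)) (hvb0 : vb 0 0 ≠ 0) :
    (∃ (r ρ : ℝ) (ψ : ℂ → ℂ → ℂ) (h : ℂ → ℂ), 0 < r ∧ 0 < ρ ∧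
      AnalyticOnNhd ℂ (fun p : ℂ × ℂ => ψ p.1 p.2) (ball 0 r ×ˢ ball 0 ρ) ∧
      ψ 0 0 = 0 ∧
      (∀ ε ∈ ball (0 : ℂ) ρ, Set.InjOn (fun z => ψ z ε) (ball 0 r)) ∧
      AnalyticOnNhd ℂ h (ball 0 ρ) ∧ h 0 = 0 ∧ deriv h 0 ≠ 0 ∧
      ∀ z ∈ ball (0 : ℂ) r, ∀ ε ∈ ball (0 : ℂ) ρ,
        deriv (fun z => ψ z ε) z * ((z ^ (k + 1) - ε) * v z ε)
          = (ψ z ε ^ (k + 1) - h ε) * vb (ψ z ε) (h ε)) ↔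
    (∃ g : ℂ → ℂ, AnalyticAt ℂ g 0 ∧ g 0 ≠ 0 ∧
      ∀ᶠ δ in nhds (0 : ℂ),
        ((k : ℂ) + 1) * δ ^ k * v δ (δ ^ (k + 1))
          = ((k : ℂ) + 1) * (δ * g (δ ^ (k + 1))) ^ k *
              vb (δ * g (δ ^ (k + 1))) ((δ * g (δ ^ (k + 1))) ^ (k + 1))) := by
  constructor
  · rintro ⟨r, ρ, ψ, h, hr, hρ, hψ, hψ0, hinj, hh, hh0, hh', hconj⟩
    exact exists_eigenvalue_of_conjugacy hk hv hv0 hvb hvb0 hr hρ hψ hψ0 hinj hh hh0 hh' hconj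
  · rintro ⟨g, hg, hg0, h⟩
    exact exists_conjugacy_of_eigenvalue hv hv0 hvb hvb0 hg hg0 h
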